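/- (Lemma 2.1, condition SI-2 for H(2r)) Let r ≥ 1, X ∈ H(2r)_{[1]} and Y ∈ H(2r)_{[−1]}. Then [X,[Y,Z]] ∈ H(2r)_{[0]} for every Z ∈ H(2r)_{[0]}, so that ad X ∘ ad Y restricts to a linear endomorphism φ of the finite-dimensional space H(2r)_{[0]}, and tr(φ) = 0. -/

import Mathlib

open MvPolynomial

noncomputable section

abbrev Wn (F : Type*) [Field F] (n : ℕ) :=
  Derivation F (MvPolynomial (Fin n) F) (MvPolynomial (Fin n) F)

/-- The submodule of polynomials homogeneous of integer degree `d`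
(for `d < 0` this is `⊥`). -/
def homZ (F : Type*) [Field F] (n : ℕ) (d : ℤ) : Submodule F (MvPolynomial (Fin n) F) where
  carrier := {p | ∀ m : Fin n →₀ ℕ, coeff m p ≠ 0 → (m.sum fun _ e => (e : ℤ)) = d}
  zero_mem' := by intro m hm; simp at hm
  add_mem' := by
    intro p q hp hq m hm
    by_cases h : coeff m p = 0
    · refine hq m fun hq0 => hm ?_
      simp [coeff_add, h, hq0]
    · exact hp m h
  smul_mem' := by
    intro c p hp m hm
    refine hp m fun h => hm ?_
    simp [coeff_smul, h]

/-- `σ(i) = 1` for `i ≤ r`, `σ(i) = -1` for `i > r` (indices `0,…,2r-1` here). -/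
def sgn (F : Type*) [Field F] (r : ℕ) (i : Fin (2 * r)) : F :=
  if (i : ℕ) < r then 1 else -1

/-- `i ↦ i′`, i.e. `i + r` for `i ≤ r` and `i - r` for `i > r`. -/
def prime (r : ℕ) (i : Fin (2 * r)) : Fin (2 * r) :=
  if h : (i : ℕ) < r then ⟨(i : ℕ) + r, by omega⟩
  else ⟨(i : ℕ) - r, by have := i.isLt; omega⟩

/-- The Hamiltonian vector field `D_H(f) = ∑ σ(i)·∂_i(f)·∂_{i′}`. -/
def DH {F : Type*} [Field F] {r : ℕ} (f : MvPolynomial (Fin (2 * r)) F) : Wn F (2 * r) :=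
  ∑ i : Fin (2 * r), (sgn F r i • (pderiv i f)) • (pderiv (prime r i) : Wn F (2 * r))


lemma DH_add {F : Type*} [Field F] {r : ℕ} (f g : MvPolynomial (Fin (2 * r)) F) :
    DH (f + g) = DH f + DH g := by
  simp [DH, smul_add, add_smul, Finset.sum_add_distrib]

lemma DH_smul {F : Type*} [Field F] {r : ℕ} (c : F) (f : MvPolynomial (Fin (2 * r)) F) :
    DH (c • f) = c • DH f := by
  simp only [DH, Finset.smul_sum]
  refine Finset.sum_congr rfl fun i _ => ?_
  rw [Derivation.map_smul, smul_comm (sgn F r i) c, smul_assoc]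

lemma DH_zero {F : Type*} [Field F] {r : ℕ} : DH (0 : MvPolynomial (Fin (2 * r)) F) = 0 := by
  simp [DH]

/-- The homogeneous component `H(2r)_{[i]} = {D_H(f) : f homogeneous of degree i+2}`,
as a submodule of `W(2r)`. -/
def Hgr (F : Type*) [Field F] (r : ℕ) (i : ℤ) : Submodule F (Wn F (2 * r)) where
  carrier := {D | ∃ f ∈ homZ F (2 * r) (i + 2), D = DH f}
  zero_mem' := ⟨0, (homZ F (2 * r) (i + 2)).zero_mem, DH_zero.symm⟩
  add_mem' := by
    rintro D E ⟨f, hf, rfl⟩ ⟨g, hg, rfl⟩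
    exact ⟨f + g, add_mem hf hg, (DH_add f g).symm⟩
  smul_mem' := by
    rintro c D ⟨f, hf, rfl⟩
    exact ⟨c • f, Submodule.smul_mem _ c hf, (DH_smul c f).symm⟩

lemma prime_prime (r : ℕ) (i : Fin (2 * r)) : prime r (prime r i) = i := by
  have := i.isLt
  ext
  unfold prime
  by_cases h : (i : ℕ) < r
  · simp [h]
  · have h' : (i : ℕ) - r < r := by omega
    simp only [h, h', dite_true, dite_false]
    omega

lemma prime_ne (r : ℕ) (i : Fin (2 * r)) : prime r i ≠ i := by
  have := i.isLt
  intro h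
  have h' := congrArg Fin.val h
  simp only [prime] at h'
  split_ifs at h' <;> simp at h' <;> omega

lemma sgn_prime (F : Type*) [Field F] (r : ℕ) (i : Fin (2 * r)) :
    sgn F r (prime r i) = -sgn F r i := by
  have := i.isLt
  simp only [sgn, prime]
  split_ifs <;> simp_all
  omega

lemma pderiv_commute {F : Type*} [Field F] {n : ℕ} (i j : Fin n)
    (p : MvPolynomial (Fin n) F) : pderiv i (pderiv j p) = pderiv j (pderiv i p) := by
  have h : ⁅(pderiv i : Wn F n), (pderiv j : Wn F n)⁆ = 0 := by
    refine MvPolynomial.derivation_ext fun k => ?_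
    simp only [Derivation.commutator_apply, pderiv_X, Derivation.coe_zero, Pi.zero_apply,
      Pi.single_apply]
    split_ifs <;> simp
  have := congrArg (fun D : Wn F n => D p) h
  simpa [Derivation.commutator_apply, sub_eq_zero] using this

lemma pderiv_mem_homZ {F : Type*} [Field F] {n : ℕ} (i : Fin n) {d : ℤ}
    {p : MvPolynomial (Fin n) F} (hp : p ∈ homZ F n d) : pderiv i p ∈ homZ F n (d - 1) := by
  intro m hm
  have h : coeff (m + Finsupp.single i 1) p ≠ 0 := by
    intro h
    apply hm
    rw [coeff_pderiv, h]
    simp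
  have := hp _ h
  rw [Finsupp.sum_add_index' (by simp) (by simp), Finsupp.sum_single_index (by simp)] at this
  push_cast at this
  linarith

lemma eq_C_of_mem_homZ_zero {F : Type*} [Field F] {n : ℕ} {p : MvPolynomial (Fin n) F}
    (hp : p ∈ homZ F n 0) : p = C (constantCoeff p) := by
  ext m
  rw [coeff_C, constantCoeff_eq]
  split_ifs with h
  · rw [h]
  · by_contra hm
    apply h
    have h0 := hp m hm
    rw [Finsupp.sum, Finset.sum_eq_zero_iff_of_nonneg (by simp)] at h0
    ext i
    by_contra hi
    have := h0 i (by simpa [eq_comm] using hi)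
    simp at this
    exact hi this.symm

lemma derivation_sum_apply {ι F : Type*} [Field F] {n : ℕ} (s : Finset ι) (D : ι → Wn F n)
    (p : MvPolynomial (Fin n) F) : (∑ i ∈ s, D i) p = ∑ i ∈ s, D i p := by
  classical
  induction s using Finset.induction_on with
  | empty => simp
  | insert i s hi ih => rw [Finset.sum_insert hi, Finset.sum_insert hi, Derivation.add_apply, ih]

lemma DH_apply {F : Type*} [Field F] {r : ℕ} (f p : MvPolynomial (Fin (2 * r)) F) :
    DH f p = ∑ i, (sgn F r i • pderiv i f) * pderiv (prime r i) p := by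
  simp [DH, derivation_sum_apply]

lemma DH_apply_X {F : Type*} [Field F] {r : ℕ} (f : MvPolynomial (Fin (2 * r)) F)
    (i : Fin (2 * r)) : DH f (X i) = -(sgn F r i • pderiv (prime r i) f) := by
  rw [DH_apply, Finset.sum_eq_single (prime r i)]
  · rw [prime_prime, sgn_prime]; simp
  · intro j _ hj
    rw [pderiv_X_of_ne (fun h => hj (by rw [h, prime_prime]))]; simp
  · simp

/-- Hamiltonian vector fields are divergence free. -/
lemma sum_pderiv_DH_apply_X {F : Type*} [Field F] {r : ℕ} (f : MvPolynomial (Fin (2 * r)) F) :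
    ∑ i, pderiv i (DH f (X i)) = 0 := by
  refine Finset.sum_involution (fun i _ => prime r i) ?_ (fun i _ _ => prime_ne r i)
    (fun i _ => Finset.mem_univ _) (fun i _ => prime_prime r i)
  intro i _
  simp only [DH_apply_X, map_neg, Derivation.map_smul, prime_prime, sgn_prime]
  rw [pderiv_commute]
  simp

lemma lie_pderiv_DH {F : Type*} [Field F] {r : ℕ} (i : Fin (2 * r))
    (f : MvPolynomial (Fin (2 * r)) F) :
    ⁅(pderiv i : Wn F (2 * r)), DH f⁆ = DH (pderiv i f) := by
  refine MvPolynomial.derivation_ext fun k => ?_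
  rw [Derivation.commutator_apply, DH_apply_X, DH_apply_X, pderiv_X]
  have : DH f (Pi.single (M := fun _ => MvPolynomial (Fin (2 * r)) F) i 1 k) = 0 := by
    rw [Pi.single_apply]
    split_ifs <;> simp
  rw [this, map_neg, Derivation.map_smul, pderiv_commute, sub_zero]

lemma lie_pderiv_mem_Hgr {F : Type*} [Field F] {r : ℕ} (i : Fin (2 * r)) {d : ℤ}
    {D : Wn F (2 * r)} (hD : D ∈ Hgr F r d) :
    ⁅(pderiv i : Wn F (2 * r)), D⁆ ∈ Hgr F r (d - 1) := by
  obtain ⟨f, hf, rfl⟩ := hD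
  refine ⟨pderiv i f, ?_, lie_pderiv_DH i f⟩
  have := pderiv_mem_homZ i hf
  rwa [show d + 2 - 1 = d - 1 + 2 by ring] at this

/-- The constant coefficient vector field `∑ v_i ∂_i`. -/
def constField (F : Type*) [Field F] (n : ℕ) : (Fin n → F) →ₗ[F] Wn F n :=
  Fintype.linearCombination F (fun i => (pderiv i : Wn F n))

lemma constField_apply {F : Type*} [Field F] {n : ℕ} (v : Fin n → F) :
    constField F n v = ∑ i, v i • (pderiv i : Wn F n) := rfl

lemma constField_apply_X {F : Type*} [Field F] {n : ℕ} (v : Fin n → F) (i : Fin n) :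
    constField F n v (X i) = C (v i) := by
  simp [constField_apply, derivation_sum_apply, pderiv_X, Pi.single_apply, smul_eq_C_mul]

/-- The value at the origin of a vector field. -/
def valueAtZero (F : Type*) [Field F] (n : ℕ) : Wn F n →ₗ[F] (Fin n → F) where
  toFun D i := constantCoeff (D (X i))
  map_add' D E := by ext; simp
  map_smul' c D := by ext; simp [smul_eq_C_mul]

lemma valueAtZero_apply {F : Type*} [Field F] {n : ℕ} (D : Wn F n) (i : Fin n) :
    valueAtZero F n D i = constantCoeff (D (X i)) := rfl

lemma constField_valueAtZero {F : Type*} [Field F] {r : ℕ} {D : Wn F (2 * r)}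
    (hD : D ∈ Hgr F r (-1)) : constField F (2 * r) (valueAtZero F (2 * r) D) = D := by
  obtain ⟨f, hf, rfl⟩ := hD
  refine MvPolynomial.derivation_ext fun i => ?_
  rw [constField_apply_X, valueAtZero_apply]
  refine (eq_C_of_mem_homZ_zero ?_).symm
  rw [DH_apply_X]
  exact neg_mem (Submodule.smul_mem _ _ (pderiv_mem_homZ (d := 1) _ hf))

lemma lie_constField_mem_Hgr {F : Type*} [Field F] {r : ℕ} (v : Fin (2 * r) → F) {d : ℤ}
    {D : Wn F (2 * r)} (hD : D ∈ Hgr F r d) :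
    ⁅D, constField F (2 * r) v⁆ ∈ Hgr F r (d - 1) := by
  rw [← lie_skew, constField_apply, sum_lie]
  refine neg_mem (Submodule.sum_mem _ fun i _ => ?_)
  have h : ⁅v i • (pderiv i : Wn F (2 * r)), D⁆ = v i • ⁅(pderiv i : Wn F (2 * r)), D⁆ := by
    ext
    simp [Derivation.commutator_apply, mul_sub]
  rw [h]
  exact Submodule.smul_mem _ _ (lie_pderiv_mem_Hgr i hD)

lemma lie_mem_Hgr {F : Type*} [Field F] {r : ℕ} {d : ℤ} {D E : Wn F (2 * r)}
    (hD : D ∈ Hgr F r d) (hE : E ∈ Hgr F r (-1)) : ⁅D, E⁆ ∈ Hgr F r (d - 1) := by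
  rw [← constField_valueAtZero hE]
  exact lie_constField_mem_Hgr _ hD

/-- No finiteness of `M` is needed, since the trace is zero by convention when `M` has no finite
basis. -/
lemma trace_comp_eq_zero_of_swap {R M ι : Type*} [CommSemiring R] [AddCommMonoid M] [Module R M]
    [Fintype ι] (A : (ι → R) →ₗ[R] M) (B : M →ₗ[R] (ι → R))
    (h : LinearMap.trace R (ι → R) (B ∘ₗ A) = 0) : LinearMap.trace R M (A ∘ₗ B) = 0 := by
  classical
  by_cases hM : ∃ s : Finset M, Nonempty (Module.Basis s R M)
  · obtain ⟨s, ⟨b⟩⟩ := hM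
    rw [LinearMap.trace_eq_matrix_trace R (Pi.basisFun R ι), LinearMap.toMatrix_comp _ b,
      Matrix.trace_mul_comm] at h
    rw [LinearMap.trace_eq_matrix_trace R b, LinearMap.toMatrix_comp _ (Pi.basisFun R ι), h]
  · rw [LinearMap.trace, dif_neg hM, LinearMap.zero_apply]

/-- With `E = constField F n v`, the trace of `w ↦ [E, [D, w]]` on constant vector fields is
minus the value at zero of `E (div D)`. -/
lemma sum_valueAtZero_lie {F : Type*} [Field F] {n : ℕ} (D : Wn F n) (v : Fin n → F) :
    ∑ i, constantCoeff (⁅constField F n v, ⁅D, (pderiv i : Wn F n)⁆⁆ (X i)) =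
      -constantCoeff (constField F n v (∑ i, pderiv i (D (X i)))) := by
  rw [map_sum, map_sum, ← Finset.sum_neg_distrib]
  refine Finset.sum_congr rfl fun i _ => ?_
  rw [Derivation.commutator_apply, constField_apply_X, Derivation.commutator_apply]
  simp [MvPolynomial.derivation_C]

/-- for `r ≥ 1`, `X ∈ H(2r)_{[1]}`, `Y ∈ H(2r)_{[−1]}`:
`ad X ∘ ad Y` preserves `H(2r)_{[0]}`, hence restricts to an endomorphism `φ`
of `H(2r)_{[0]}`, and `tr(φ) = 0`. -/
theorem stmt15 (F : Type*) [Field F] [CharZero F] (r : ℕ) (hr : 1 ≤ r)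
    (X Y : Wn F (2 * r)) (hX : X ∈ Hgr F r 1) (hY : Y ∈ Hgr F r (-1)) :
    ∃ h : ∀ z ∈ Hgr F r 0,
        ((LieAlgebra.ad F (Wn F (2 * r)) X) ∘ₗ (LieAlgebra.ad F (Wn F (2 * r)) Y)) z
          ∈ Hgr F r 0,
      LinearMap.trace F ↥(Hgr F r 0)
        (LinearMap.restrict ((LieAlgebra.ad F (Wn F (2 * r)) X) ∘ₗ
          (LieAlgebra.ad F (Wn F (2 * r)) Y)) h) = 0 := by
  have hYZ : ∀ z ∈ Hgr F r 0, ⁅Y, z⁆ ∈ Hgr F r (-1) := fun z hz => by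
    rw [← lie_skew]
    exact neg_mem (lie_mem_Hgr hz hY)
  refine ⟨fun z hz => lie_mem_Hgr hX (hYZ z hz), ?_⟩
  let A : (Fin (2 * r) → F) →ₗ[F] Hgr F r 0 :=
    ((LieAlgebra.ad F (Wn F (2 * r)) X) ∘ₗ constField F (2 * r)).codRestrict _
      fun v => lie_constField_mem_Hgr v hX
  let B : Hgr F r 0 →ₗ[F] (Fin (2 * r) → F) :=
    valueAtZero F (2 * r) ∘ₗ (LieAlgebra.ad F (Wn F (2 * r)) Y) ∘ₗ (Hgr F r 0).subtype
  have hAB : LinearMap.restrict ((LieAlgebra.ad F (Wn F (2 * r)) X) ∘ₗ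
      (LieAlgebra.ad F (Wn F (2 * r)) Y)) (fun z hz => lie_mem_Hgr hX (hYZ z hz)) = A ∘ₗ B := by
    ext1 z
    apply Subtype.ext
    change ⁅X, ⁅Y, (z : Wn F (2 * r))⁆⁆ =
      ⁅X, constField F (2 * r) (valueAtZero F (2 * r) ⁅Y, (z : Wn F (2 * r))⁆)⁆
    rw [constField_valueAtZero (hYZ z z.2)]
  rw [hAB]
  refine trace_comp_eq_zero_of_swap A B ?_
  rw [LinearMap.trace_eq_matrix_trace F (Pi.basisFun F _),
    Matrix.trace]
  have hdiag : ∀ i, (LinearMap.toMatrix (Pi.basisFun F _) (Pi.basisFun F _) (B ∘ₗ A)).diag i =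
      constantCoeff (⁅Y, ⁅X, (pderiv i : Wn F (2 * r))⁆⁆ (MvPolynomial.X i)) := by
    intro i
    rw [Matrix.diag_apply, LinearMap.toMatrix_apply, Pi.basisFun_apply, Pi.basisFun_repr]
    change constantCoeff
      (⁅Y, ⁅X, constField F (2 * r) (Pi.single i 1)⁆⁆ (MvPolynomial.X i)) = _
    rw [constField, Fintype.linearCombination_apply_single, one_smul]
  rw [Finset.sum_congr rfl fun i _ => hdiag i, ← constField_valueAtZero hY, sum_valueAtZero_lie]
  obtain ⟨f, -, rfl⟩ := hX
  rw [sum_pderiv_DH_apply_X]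
  simp
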